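/- arXiv:1804.02046 — 2 statements merged into one kernel-verified Lean document; each statement's English description precedes it below -/
import Mathlib

section
/- Suppose α = 0 and fix i = 1 (forward difference case). For each fixed integer k with 0 ≤ k ≤ j, lim_{n→∞} a_n^{(k)} = 0 and lim_{n→∞} b_n^{(k)} = 0. -/
open Finset Filter Topology Polynomial

noncomputable section

/-- Pochhammer symbol `(a)_k = a(a+1)⋯(a+k−1)`. -/
def poch (a : ℝ) (k : ℕ) : ℝ := ∏ m ∈ Finset.range k, (a + m)

/-- Falling factorial `[x]_k = x(x−1)⋯(x−k+1)`. -/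
def fall (x : ℝ) (k : ℕ) : ℝ := ∏ m ∈ Finset.range k, (x - m)

/-- `⟨x⟩_i^k`: falling factorial for `i = 1`, Pochhammer symbol for `i = 2`. -/
def br (i : ℕ) (x : ℝ) (k : ℕ) : ℝ := if i = 1 then fall x k else poch x k

/-- Forward (`i = 1`) resp. backward (`i = 2`) difference operator `𝒟_i`. -/
def Dop (i : ℕ) (f : ℝ → ℝ) : ℝ → ℝ :=
  fun x => if i = 1 then f (x + 1) - f x else f x - f (x - 1)

/-- Iterated difference operator `𝒟_i^k`. -/
def Dk (i k : ℕ) (f : ℝ → ℝ) : ℝ → ℝ := (Dop i)^[k] f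

/-- Kronecker delta `δ_{i,m}` (real valued). -/
def kdelta (i m : ℕ) : ℝ := if i = m then 1 else 0

/-- The shift `x ± 1`: `x + 1` for `i = 1`, `x - 1` for `i = 2`. -/
def sh (i : ℕ) (x : ℝ) : ℝ := if i = 1 then x + 1 else x - 1

/-- Monic Meixner polynomial `M_n(x)`. -/
def MeixnerM (γ μ : ℝ) (n : ℕ) (x : ℝ) : ℝ :=
  poch γ n * (μ / (μ - 1)) ^ n *
    ∑ k ∈ Finset.range (n + 1),
      poch (-(n : ℝ)) k * poch (-x) k / poch γ k * (1 - μ⁻¹) ^ k / (Nat.factorial k : ℝ)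

/-- Meixner inner product `⟨p,q⟩ = ∑_{x≥0} p(x)q(x) μ^x (γ)_x / x!`. -/
def mIP (γ μ : ℝ) (p q : ℝ → ℝ) : ℝ :=
  ∑' x : ℕ, p x * q x * μ ^ x * poch γ x / (Nat.factorial x : ℝ)

/-- Squared Meixner norm `‖M_n‖²`. -/
def nrm2 (γ μ : ℝ) (n : ℕ) : ℝ := mIP γ μ (MeixnerM γ μ n) (MeixnerM γ μ n)

/-- Kernel `K_n^{(l,m)}(x,y)` for the operator `𝒟_i`. -/
def Klm (γ μ : ℝ) (i l m n : ℕ) (x y : ℝ) : ℝ :=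
  ∑ k ∈ Finset.range (n + 1),
    Dk i l (MeixnerM γ μ k) x * Dk i m (MeixnerM γ μ k) y / nrm2 γ μ k

/-- Sobolev inner product `⟨p,q⟩_λ = ⟨p,q⟩ + λ 𝒟_i^j p(α) 𝒟_i^j q(α)`. -/
def sIP (γ μ lam α : ℝ) (i j : ℕ) (p q : ℝ → ℝ) : ℝ :=
  mIP γ μ p q + lam * Dk i j p α * Dk i j q α

/-- `Q` is the monic Sobolev orthogonal polynomial of degree `n`. -/
def IsSobolevOP (γ μ lam α : ℝ) (i j n : ℕ) (Q : Polynomial ℝ) : Prop :=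
  Q.Monic ∧ Q.natDegree = n ∧
    ∀ p : Polynomial ℝ, p.degree < (n : WithBot ℕ) →
      sIP γ μ lam α i j (fun x => Q.eval x) (fun x => p.eval x) = 0

/-- Coefficient `a_n^{(k)}`. -/
def acoef (γ μ lam α : ℝ) (i j n k : ℕ) : ℝ :=
  -(lam * (Nat.factorial j : ℝ) * Dk i j (MeixnerM γ μ n) α * Dk i k (MeixnerM γ μ (n - 1)) α) /
    ((Nat.factorial k : ℝ) * nrm2 γ μ (n - 1) * (1 + lam * Klm γ μ i j j (n - 1) α α))

/-- Coefficient `b_n^{(k)}`. -/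
def bcoef (γ μ lam α : ℝ) (i j n k : ℕ) : ℝ :=
  lam * (Nat.factorial j : ℝ) * Dk i j (MeixnerM γ μ n) α * Dk i k (MeixnerM γ μ n) α /
    ((Nat.factorial k : ℝ) * nrm2 γ μ (n - 1) * (1 + lam * Klm γ μ i j j (n - 1) α α))

/-- Rational function `A_{1,n}(x)`. -/
def A1 (γ μ lam α : ℝ) (i j n : ℕ) (x : ℝ) : ℝ :=
  1 + (1 / br i (x - α) (j + 1)) *
    ∑ k ∈ Finset.range (j + 1), acoef γ μ lam α i j n k * br i (x - α) k

/-- Rational function `B_{1,n}(x)`. -/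
def B1 (γ μ lam α : ℝ) (i j n : ℕ) (x : ℝ) : ℝ :=
  (1 / br i (x - α) (j + 1)) *
    ∑ k ∈ Finset.range (j + 1), bcoef γ μ lam α i j n k * br i (x - α) k

/-- Meixner recurrence coefficient `α_n`. -/
def alphaR (γ μ : ℝ) (n : ℕ) : ℝ := ((n : ℝ) * (1 + μ) + μ * γ) / (1 - μ)

/-- Meixner recurrence coefficient `β_n`. -/
def betaR (γ μ : ℝ) (n : ℕ) : ℝ := (n : ℝ) * μ * ((n : ℝ) + γ - 1) / (1 - μ) ^ 2

/-- Rational function `A_{2,n}(x)`. -/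
def A2 (γ μ lam α : ℝ) (i j n : ℕ) (x : ℝ) : ℝ :=
  -(B1 γ μ lam α i j (n - 1) x) / betaR γ μ (n - 1)

/-- Rational function `B_{2,n}(x)`. -/
def B2 (γ μ lam α : ℝ) (i j n : ℕ) (x : ℝ) : ℝ :=
  A1 γ μ lam α i j (n - 1) x + A2 γ μ lam α i j n x * (alphaR γ μ (n - 1) - x)

/-- Rational function `C_{1,n}(x)`. -/
def C1 (γ μ lam α : ℝ) (i j n : ℕ) (x : ℝ) : ℝ :=
  (x + γ * kdelta i 1) * Dop i (A1 γ μ lam α i j n) x + (n : ℝ) * A1 γ μ lam α i j n (sh i x)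
    - ((n : ℝ) - 1) * ((n : ℝ) + γ - 2) * μ ^ kdelta i 2 * B1 γ μ lam α i j n (sh i x) /
        (betaR γ μ (n - 1) * (1 - μ))

/-- Rational function `D_{1,n}(x)`. -/
def D1 (γ μ lam α : ℝ) (i j n : ℕ) (x : ℝ) : ℝ :=
  (x + γ * kdelta i 1) * Dop i (B1 γ μ lam α i j n) x
    + ((n : ℝ) - 1) * B1 γ μ lam α i j n (sh i x)
    + ((n : ℝ) - 1) * ((n : ℝ) + γ - 2) * (x - alphaR γ μ (n - 1)) * μ ^ kdelta i 2 *
        B1 γ μ lam α i j n (sh i x) / (betaR γ μ (n - 1) * (1 - μ))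
    + (n : ℝ) * ((n : ℝ) + γ - 1) * μ ^ kdelta i 2 * A1 γ μ lam α i j n (sh i x) / (1 - μ)

/-- Rational function `C_{2,n}(x)`. -/
def C2 (γ μ lam α : ℝ) (i j n : ℕ) (x : ℝ) : ℝ :=
  -(D1 γ μ lam α i j (n - 1) x) / betaR γ μ (n - 1)

/-- Rational function `D_{2,n}(x)`. -/
def D2 (γ μ lam α : ℝ) (i j n : ℕ) (x : ℝ) : ℝ :=
  C1 γ μ lam α i j (n - 1) x + C2 γ μ lam α i j n x * (alphaR γ μ (n - 1) - x)

/-- `A_{m,n}(x)` for `m = 1, 2`. -/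
def Aa (γ μ lam α : ℝ) (i j n m : ℕ) (x : ℝ) : ℝ :=
  if m = 1 then A1 γ μ lam α i j n x else A2 γ μ lam α i j n x

/-- `B_{m,n}(x)` for `m = 1, 2`. -/
def Bb (γ μ lam α : ℝ) (i j n m : ℕ) (x : ℝ) : ℝ :=
  if m = 1 then B1 γ μ lam α i j n x else B2 γ μ lam α i j n x

/-- `C_{k,n}(x)` for `k = 1, 2`. -/
def Cc (γ μ lam α : ℝ) (i j n k : ℕ) (x : ℝ) : ℝ :=
  if k = 1 then C1 γ μ lam α i j n x else C2 γ μ lam α i j n x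

/-- `D_{k,n}(x)` for `k = 1, 2`. -/
def Dd (γ μ lam α : ℝ) (i j n k : ℕ) (x : ℝ) : ℝ :=
  if k = 1 then D1 γ μ lam α i j n x else D2 γ μ lam α i j n x

/-- `Λ_{m,n}^{(k)}(x) = (−1)^k (C_{k,n}(x) B_{m,n}(x) − A_{m,n}(x) D_{k,n}(x))`. -/
def Lam (γ μ lam α : ℝ) (i j n m k : ℕ) (x : ℝ) : ℝ :=
  (-1 : ℝ) ^ k * (Cc γ μ lam α i j n k x * Bb γ μ lam α i j n m x
    - Aa γ μ lam α i j n m x * Dd γ μ lam α i j n k x)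

/-- `Θ_n(x) = A_{1,n}(x) B_{2,n}(x) − B_{1,n}(x) A_{2,n}(x)`. -/
def Theta (γ μ lam α : ℝ) (i j n : ℕ) (x : ℝ) : ℝ :=
  A1 γ μ lam α i j n x * B2 γ μ lam α i j n x - B1 γ μ lam α i j n x * A2 γ μ lam α i j n x

/-- `Θ̃_n(x) = (x + γ δ_{i,1}) Θ_n(x)`. -/
def Thetatil (γ μ lam α : ℝ) (i j n : ℕ) (x : ℝ) : ℝ :=
  (x + γ * kdelta i 1) * Theta γ μ lam α i j n x

theorem poch_succ (a : ℝ) (k : ℕ) : poch a (k + 1) = poch a k * (a + k) :=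
  Finset.prod_range_succ _ _

theorem poch_succ_left (a : ℝ) (k : ℕ) : poch a (k + 1) = a * poch (a + 1) k := by
  simp only [poch, Finset.prod_range_succ', mul_comm a]
  congr 1
  · exact Finset.prod_congr rfl fun m _ => by push_cast; ring
  · simp

theorem poch_add (a : ℝ) (k m : ℕ) : poch a (k + m) = poch a k * poch (a + k) m := by
  simp [poch, Finset.prod_range_add, add_assoc]

theorem poch_pos {a : ℝ} (ha : 0 < a) (k : ℕ) : 0 < poch a k :=
  Finset.prod_pos fun m _ => by positivity

theorem poch_zero_left (k : ℕ) : poch 0 k = if k = 0 then 1 else 0 := by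
  cases k with
  | zero => simp [poch]
  | succ k => simp [poch_succ_left]

theorem poch_neg_natCast (n k : ℕ) : poch (-(n : ℝ)) k = (-1) ^ k * (n.descFactorial k : ℝ) := by
  induction k with
  | zero => simp [poch]
  | succ k ih =>
    rw [poch_succ, ih, Nat.descFactorial_succ]
    rcases le_or_gt k n with h | h
    · push_cast [h]; ring
    · simp [Nat.descFactorial_of_lt h]

theorem poch_eq_eval_ascPochhammer (a : ℝ) (n : ℕ) : poch a n = (ascPochhammer ℝ n).eval a := by
  induction n with
  | zero => simp [poch]
  | succ n ih => rw [poch_succ, ih, ascPochhammer_succ_eval]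

theorem poch_div_factorial (a : ℝ) (n : ℕ) :
    poch a n / (n.factorial : ℝ) = Ring.choose (a + n - 1) n := by
  have h := Ring.factorial_nsmul_multichoose_eq_ascPochhammer a n
  rw [ascPochhammer_smeval_eq_eval, ← poch_eq_eval_ascPochhammer, nsmul_eq_mul] at h
  rw [Ring.choose, ← h, mul_div_cancel_left₀ _ (by positivity)]
  congr 1
  ring

theorem hasSum_pow_mul_poch {a t : ℝ} (ht : |t| < 1) :
    HasSum (fun x : ℕ => t ^ x * poch a x / (x.factorial : ℝ)) ((1 - t) ^ (-a)) := by
  have h := (Real.one_div_one_sub_rpow_hasFPowerSeriesOnBall_zero a).hasSum (y := t)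
    (by simpa [Metric.mem_eball, edist_zero_right, enorm_eq_nnnorm, ← NNReal.coe_lt_one] using ht)
  rw [abs_lt] at ht
  convert! h using 1
  · ext x
    rw [mul_div_assoc, poch_div_factorial]
    simp
  · rw [zero_add, Real.rpow_neg (by linarith), one_div]

theorem hasSum_poch_neg_mul_pow_mul_poch {a t : ℝ} (ht : |t| < 1) (k : ℕ) :
    HasSum (fun x : ℕ => poch (-(x : ℝ)) k * t ^ x * poch a x / (x.factorial : ℝ))
      ((-t) ^ k * poch a k * (1 - t) ^ (-(a + k))) := by
  rw [← hasSum_nat_add_iff' k, Finset.sum_eq_zero, sub_zero]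
  · refine ((hasSum_pow_mul_poch (a := a + k) ht).mul_left ((-t) ^ k * poch a k)).congr_fun ?_
    intro x
    have h := Nat.factorial_mul_descFactorial (Nat.le_add_left k x)
    rw [Nat.add_sub_cancel] at h
    rw [poch_neg_natCast, ← h, add_comm x k, poch_add, pow_add, neg_pow t k]
    have h0 : ((k + x).descFactorial k : ℝ) ≠ 0 := by
      exact_mod_cast (Nat.descFactorial_pos.2 (by omega)).ne'
    push_cast
    field_simp
  · intro x hx
    rw [poch_neg_natCast, Nat.descFactorial_of_lt (Finset.mem_range.1 hx)]
    simp

/-- The pairing of `M_n` with `x ↦ (-1)^x` in closed form. -/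
theorem hasSum_meixnerM_mul_neg_pow {γ μ : ℝ} (hγ : 0 < γ) (hμ0 : 0 < μ) (hμ1 : μ < 1) (n : ℕ) :
    HasSum (fun x : ℕ => MeixnerM γ μ n x * (-μ) ^ x * poch γ x / (x.factorial : ℝ))
      (poch γ n * (μ / (μ - 1)) ^ n * (1 + μ) ^ (-γ) * (2 / (1 + μ)) ^ n) := by
  have ht : |(-μ)| < 1 := by rwa [abs_neg, abs_of_pos hμ0]
  have h := (hasSum_sum fun k (_ : k ∈ Finset.range (n + 1)) =>
    (hasSum_poch_neg_mul_pow_mul_poch (a := γ) ht k).mul_left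
      (poch (-(n : ℝ)) k / poch γ k * (1 - μ⁻¹) ^ k / (k.factorial : ℝ))).mul_left
    (poch γ n * (μ / (μ - 1)) ^ n)
  convert! h using 1
  · ext x
    simp only [MeixnerM, mul_assoc, Finset.sum_mul, Finset.sum_div, mul_div_assoc]
    congr 2
    refine Finset.sum_congr rfl fun k _ => ?_
    ring
  · rw [mul_assoc]
    congr 1
    have h2 : 2 / (1 + μ) = (1 - μ) / (1 + μ) + 1 := by field_simp; ring
    rw [h2, add_pow, Finset.mul_sum]
    refine Finset.sum_congr rfl fun k _ => ?_
    have hp := (poch_pos hγ k).ne'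
    rw [poch_neg_natCast, Nat.descFactorial_eq_factorial_mul_choose, sub_neg_eq_add, neg_neg,
      neg_add, Real.rpow_add (by positivity), Real.rpow_neg (by positivity) (k : ℝ),
      Real.rpow_natCast, div_pow]
    have h3 : (1 - μ) ^ k = (-1) ^ k * (1 - μ⁻¹) ^ k * μ ^ k := by
      rw [← mul_pow, ← mul_pow]; congr 1; field_simp; ring
    rw [h3]
    push_cast
    field_simp
    simp

theorem nrm2_nonneg {γ μ : ℝ} (hγ : 0 < γ) (hμ0 : 0 < μ) (n : ℕ) : 0 ≤ nrm2 γ μ n :=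
  tsum_nonneg fun x => by
    have := poch_pos hγ x
    have := mul_self_nonneg (MeixnerM γ μ n x)
    positivity

/-- Weighted Cauchy–Schwarz against a sign sequence. -/
theorem sq_le_tsum_mul_tsum {f w s : ℕ → ℝ} {A W : ℝ} (hw : ∀ x, 0 ≤ w x) (hs : ∀ x, s x ^ 2 = 1)
    (hW : HasSum w W) (hW0 : 0 < W) (hA : HasSum (fun x => f x * s x * w x) A)
    (hf : Summable fun x => f x * f x * w x) : A ^ 2 ≤ (∑' x, f x * f x * w x) * W := by
  have h := hasSum_le (fun x => ?_) ((hA.mul_left (2 * (A / W))).sub (hW.mul_left ((A / W) ^ 2)))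
    hf.hasSum
  · rw [← div_le_iff₀ hW0]
    refine le_of_eq_of_le ?_ h
    field_simp
    ring
  · linear_combination mul_nonneg (hw x) (sq_nonneg (f x - A / W * s x)) +
      (A / W) ^ 2 * w x * hs x

/-- A lower bound for the norms; if the norm series diverged, its junk value `0` would do. -/
theorem inv_nrm2_le {γ μ : ℝ} (hγ : 0 < γ) (hμ0 : 0 < μ) (hμ1 : μ < 1) :
    ∃ C > 0, ∀ n, (nrm2 γ μ n)⁻¹ ≤
      C * (((1 + μ) / 2) ^ n / (poch γ n * (μ / (1 - μ)) ^ n)) ^ 2 := by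
  have h1μ : 0 < 1 - μ := by linarith
  set W := (1 - μ) ^ (-γ)
  have hW0 : 0 < W := Real.rpow_pos_of_pos h1μ _
  have hc : 0 < (1 + μ) ^ (-γ) := Real.rpow_pos_of_pos (by linarith) _
  refine ⟨W / ((1 + μ) ^ (-γ)) ^ 2, by positivity, fun n => ?_⟩
  have hp := poch_pos hγ n
  by_cases hf : Summable fun x : ℕ =>
      MeixnerM γ μ n x * MeixnerM γ μ n x * (μ ^ x * poch γ x / (x.factorial : ℝ))
  · have hA := hasSum_meixnerM_mul_neg_pow hγ hμ0 hμ1 n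
    have key := sq_le_tsum_mul_tsum (f := fun x : ℕ => MeixnerM γ μ n x) (s := fun x => (-1) ^ x)
      (w := fun x => μ ^ x * poch γ x / (x.factorial : ℝ))
      (fun x => by have := poch_pos hγ x; positivity)
      (fun x => by rw [← pow_mul, mul_comm, pow_mul]; simp)
      (hasSum_pow_mul_poch (by rwa [abs_of_pos hμ0])) hW0
      (hA.congr_fun fun x => by rw [neg_pow]; ring) hf
    have hn : ∑' x : ℕ, MeixnerM γ μ n x * MeixnerM γ μ n x *
        (μ ^ x * poch γ x / (x.factorial : ℝ)) = nrm2 γ μ n :=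
      tsum_congr fun x => by ring
    rw [hn] at key
    have hneg : μ / (μ - 1) = -(μ / (1 - μ)) := by
      rw [← div_neg]; congr 1; ring
    have hsq : (poch γ n * (μ / (μ - 1)) ^ n * (1 + μ) ^ (-γ) * (2 / (1 + μ)) ^ n) ^ 2
        = (poch γ n * (μ / (1 - μ)) ^ n * (1 + μ) ^ (-γ) * (2 / (1 + μ)) ^ n) ^ 2 := by
      rw [hneg, neg_pow]
      have : (((-1 : ℝ)) ^ n) ^ 2 = 1 := by rw [← pow_mul, mul_comm, pow_mul]; simp
      linear_combination
        (poch γ n * (μ / (1 - μ)) ^ n * (1 + μ) ^ (-γ) * (2 / (1 + μ)) ^ n) ^ 2 * this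
    rw [hsq] at key
    set B := poch γ n * (μ / (1 - μ)) ^ n * (1 + μ) ^ (-γ) * (2 / (1 + μ)) ^ n with hB
    have hB0 : 0 < B := by positivity
    have hN : 0 < nrm2 γ μ n := by
      by_contra! h
      nlinarith [pow_pos hB0 2]
    have hrw : W / ((1 + μ) ^ (-γ)) ^ 2 *
        (((1 + μ) / 2) ^ n / (poch γ n * (μ / (1 - μ)) ^ n)) ^ 2 = W / B ^ 2 := by
      rw [hB, div_pow 2, div_pow (1 + μ)]
      field_simp
    rw [hrw, le_div_iff₀ (by positivity), inv_mul_le_iff₀ hN]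
    exact key
  · have hn : nrm2 γ μ n = 0 := by
      rw [← tsum_eq_zero_of_not_summable hf]
      exact tsum_congr fun x => by ring
    rw [hn, inv_zero]
    positivity

theorem Dop_one_eq_fwdDiff : Dop 1 = fwdDiff (1 : ℝ) := by
  ext f x
  simp [Dop, fwdDiff]

theorem Dk_one_poch_neg (k m : ℕ) :
    Dk 1 m (fun x => poch (-x) k) =
      fun x => (-1) ^ m * (k.descFactorial m : ℝ) * poch (-x) (k - m) := by
  induction m with
  | zero => simp [Dk]
  | succ m ih =>
    rw [Dk] at ih
    rw [Dk, Function.iterate_succ_apply', ih]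
    ext x
    simp only [Dop, if_true, Nat.descFactorial_succ]
    rcases Nat.eq_zero_or_pos (k - m) with h | h
    · simp [h, poch]
    · obtain ⟨l, hl⟩ := Nat.exists_eq_succ_of_ne_zero h.ne'
      have hl' : k - (m + 1) = l := by omega
      rw [hl, hl', Nat.succ_eq_add_one, poch_succ_left (-(x + 1)), poch_succ,
        show -(x + 1) + 1 = -x by ring]
      push_cast
      ring

theorem Dk_one_poch_neg_zero (k m : ℕ) :
    Dk 1 m (fun x => poch (-x) k) 0 = if k = m then (-1) ^ m * (m.factorial : ℝ) else 0 := by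
  rw [Dk_one_poch_neg]
  simp only [neg_zero, poch_zero_left]
  rcases lt_trichotomy k m with h | h | h
  · simp [Nat.descFactorial_of_lt h, h.ne]
  · simp [h, Nat.descFactorial_self]
  · simp [h.ne', Nat.sub_eq_zero_iff_le, h.not_ge]

theorem Dk_one_meixnerM_zero (γ μ : ℝ) (n m : ℕ) :
    Dk 1 m (MeixnerM γ μ n) 0 = poch γ n * (μ / (μ - 1)) ^ n *
      ((n.descFactorial m : ℝ) / poch γ m * (1 - μ⁻¹) ^ m) := by
  have hM : MeixnerM γ μ n = (poch γ n * (μ / (μ - 1)) ^ n) •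
      ∑ k ∈ Finset.range (n + 1),
        (poch (-(n : ℝ)) k / poch γ k * (1 - μ⁻¹) ^ k / (k.factorial : ℝ)) •
          (fun x : ℝ => poch (-x) k) := by
    ext x
    simp only [MeixnerM, Pi.smul_apply, Finset.sum_apply, smul_eq_mul]
    congr 1
    exact Finset.sum_congr rfl fun k _ => by ring
  have hD (k : ℕ) : (fwdDiff (1 : ℝ))^[m] (fun x : ℝ => poch (-x) k) 0 =
      if k = m then (-1) ^ m * (m.factorial : ℝ) else 0 := by
    rw [← Dk_one_poch_neg_zero, Dk, Dop_one_eq_fwdDiff]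
  rw [Dk, Dop_one_eq_fwdDiff, hM, fwdDiff_iter_const_smul, fwdDiff_iter_finsetSum]
  simp only [fwdDiff_iter_const_smul, Pi.smul_apply, Finset.sum_apply, smul_eq_mul, hD,
    mul_ite, mul_zero, Finset.sum_ite_eq', Finset.mem_range]
  split_ifs with h
  · rw [poch_neg_natCast]
    have h1 : ((-1 : ℝ) ^ m * (-1) ^ m) * ((m.factorial : ℝ) * (m.factorial : ℝ)⁻¹) = 1 := by
      rw [← mul_pow, mul_inv_cancel₀ (by positivity)]
      simp
    simp only [div_eq_mul_inv]
    linear_combination poch γ n * (μ * (μ - 1)⁻¹) ^ n * (n.descFactorial m : ℝ) *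
      (poch γ m)⁻¹ * (1 - μ⁻¹) ^ m * h1
  · rw [Nat.descFactorial_of_lt (by omega)]
    simp

theorem abs_Dk_one_meixnerM_zero_le {γ μ : ℝ} (hγ : 0 < γ) (hμ0 : 0 < μ) (hμ1 : μ < 1) (m : ℕ) :
    ∃ C > 0, ∀ n : ℕ, |Dk 1 m (MeixnerM γ μ n) 0| ≤
      C * (poch γ n * (μ / (1 - μ)) ^ n * (n : ℝ) ^ m) := by
  have h1μ : 0 < 1 - μ := by linarith
  have hne : 1 - μ⁻¹ ≠ 0 := by
    have := (one_lt_inv₀ hμ0).2 hμ1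
    linarith
  have hm := poch_pos hγ m
  refine ⟨|1 - μ⁻¹| ^ m / poch γ m, by positivity, fun n => ?_⟩
  have hn := poch_pos hγ n
  have hd : (n.descFactorial m : ℝ) ≤ (n : ℝ) ^ m := by
    exact_mod_cast Nat.descFactorial_le_pow n m
  rw [Dk_one_meixnerM_zero]
  simp only [abs_mul, abs_div, abs_pow, abs_of_pos hn, abs_of_pos hm, abs_of_pos hμ0, Nat.abs_cast,
    abs_sub_comm μ 1, abs_of_pos h1μ]
  calc _ = |1 - μ⁻¹| ^ m / poch γ m * (poch γ n * (μ / (1 - μ)) ^ n * (n.descFactorial m : ℝ)) := by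
        ring
    _ ≤ _ := by gcongr

theorem Klm_diag_nonneg {γ μ : ℝ} (hγ : 0 < γ) (hμ0 : 0 < μ) (i j n : ℕ) (x : ℝ) :
    0 ≤ Klm γ μ i j j n x x :=
  Finset.sum_nonneg fun k _ => div_nonneg (mul_self_nonneg _) (nrm2_nonneg hγ hμ0 k)

theorem tendsto_add_one_pow_mul_pow (p : ℕ) {r : ℝ} (hr0 : 0 < r) (hr1 : r < 1) :
    Tendsto (fun m : ℕ => ((m : ℝ) + 1) ^ p * r ^ m) atTop (𝓝 0) := by
  have h := ((tendsto_add_atTop_iff_nat 1).2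
    (tendsto_pow_const_mul_const_pow_of_lt_one p hr0.le hr1)).mul_const r⁻¹
  rw [zero_mul] at h
  refine h.congr fun m => ?_
  push_cast
  field_simp
  ring

/-- Both coefficient sequences have this shape, up to a constant factor, with `e = 0` for
`a_n^{(k)}` and `e = 1` for `b_n^{(k)}`. -/
theorem tendsto_Dk_mul_Dk_div {γ μ lam : ℝ} (hγ : 0 < γ) (hμ0 : 0 < μ) (hμ1 : μ < 1)
    (hlam : 0 < lam) (j k : ℕ) {e : ℕ} (he : e ≤ 1) :
    Tendsto (fun m : ℕ => Dk 1 j (MeixnerM γ μ (m + 1)) 0 * Dk 1 k (MeixnerM γ μ (m + e)) 0 *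
      ((nrm2 γ μ m)⁻¹ * (1 + lam * Klm γ μ 1 j j m 0 0)⁻¹)) atTop (𝓝 0) := by
  obtain ⟨C, hC, hCn⟩ := inv_nrm2_le hγ hμ0 hμ1
  obtain ⟨Cj, hCj, hj⟩ := abs_Dk_one_meixnerM_zero_le hγ hμ0 hμ1 j
  obtain ⟨Ck, hCk, hk⟩ := abs_Dk_one_meixnerM_zero_le hγ hμ0 hμ1 k
  have h1μ : 0 < 1 - μ := by linarith
  set q := μ / (1 - μ)
  have hq0 : 0 < q := by positivity
  have hgrow (m : ℕ) {d : ℕ} (hd : d ≤ 1) (l : ℕ) :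
      poch γ (m + d) * q ^ (m + d) * ((m + d : ℕ) : ℝ) ^ l ≤
        ((γ + 1) * (q + 1)) * (poch γ m * q ^ m * ((m : ℝ) + 1) ^ (l + 1)) := by
    have hp := poch_pos hγ m
    have h1 : poch γ (m + d) ≤ poch γ m * ((γ + 1) * ((m : ℝ) + 1)) := by
      interval_cases d
      · exact le_mul_of_one_le_right hp.le (by nlinarith [(Nat.cast_nonneg m : (0 : ℝ) ≤ m)])
      · rw [poch_succ]
        gcongr
        nlinarith [(Nat.cast_nonneg m : (0 : ℝ) ≤ m)]
    have h2 : q ^ (m + d) ≤ q ^ m * (q + 1) := by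
      interval_cases d
      · exact le_mul_of_one_le_right (by positivity) (by linarith)
      · rw [pow_succ]; gcongr; linarith
    have h3 : ((m + d : ℕ) : ℝ) ≤ (m : ℝ) + 1 := by exact_mod_cast by omega
    calc poch γ (m + d) * q ^ (m + d) * ((m + d : ℕ) : ℝ) ^ l
        ≤ (poch γ m * ((γ + 1) * ((m : ℝ) + 1))) * (q ^ m * (q + 1)) * ((m : ℝ) + 1) ^ l := by
          gcongr
      _ = _ := by ring
  set D := (γ + 1) * (q + 1)
  have hr := (tendsto_add_one_pow_mul_pow (j + k + 2) (r := ((1 + μ) / 2) ^ 2) (by positivity)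
    (by nlinarith)).const_mul (Cj * D * (Ck * D) * C)
  rw [mul_zero] at hr
  refine squeeze_zero_norm (fun m => ?_) hr
  have hp := poch_pos hγ m
  have hN := nrm2_nonneg hγ hμ0 m
  have hK : (1 + lam * Klm γ μ 1 j j m 0 0)⁻¹ ≤ 1 :=
    inv_le_one_of_one_le₀ (by
      have := mul_nonneg hlam.le (Klm_diag_nonneg hγ hμ0 1 j m 0)
      linarith)
  have hK0 : 0 ≤ (1 + lam * Klm γ μ 1 j j m 0 0)⁻¹ := by
    have := mul_nonneg hlam.le (Klm_diag_nonneg hγ hμ0 1 j m 0)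
    positivity
  rw [Real.norm_eq_abs, abs_mul, abs_mul, abs_of_nonneg (mul_nonneg (inv_nonneg.2 hN) hK0)]
  calc _ ≤ Cj * (D * (poch γ m * q ^ m * ((m : ℝ) + 1) ^ (j + 1))) *
          (Ck * (D * (poch γ m * q ^ m * ((m : ℝ) + 1) ^ (k + 1)))) *
          (C * (((1 + μ) / 2) ^ m / (poch γ m * q ^ m)) ^ 2 * 1) := by
        gcongr
        · exact (hj _).trans (mul_le_mul_of_nonneg_left (hgrow m le_rfl j) hCj.le)
        · exact (hk _).trans (mul_le_mul_of_nonneg_left (hgrow m he k) hCk.le)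
        · exact hCn m
    _ = _ := by
        rw [pow_right_comm ((1 + μ) / 2) 2 m]
        generalize ((1 + μ) / 2) ^ m = t
        field_simp
        ring

/-- for `α = 0` and `i = 1`, the coefficients `a_n^{(k)}`, `b_n^{(k)}` tend to `0`. -/
theorem coefficients_tend_to_zero (γ μ lam : ℝ) (hγ : 0 < γ) (hμ0 : 0 < μ) (hμ1 : μ < 1)
    (hlam : 0 < lam) (j k : ℕ) (hk : k ≤ j) :
    Tendsto (fun n : ℕ => acoef γ μ lam 0 1 j n k) atTop (𝓝 0) ∧
    Tendsto (fun n : ℕ => bcoef γ μ lam 0 1 j n k) atTop (𝓝 0) := by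
  constructor
  · rw [← tendsto_add_atTop_iff_nat 1]
    have h := (tendsto_Dk_mul_Dk_div hγ hμ0 hμ1 hlam j k zero_le_one).const_mul
      (-(lam * (j.factorial : ℝ) / (k.factorial : ℝ)))
    rw [mul_zero] at h
    refine h.congr fun m => ?_
    simp only [acoef, Nat.add_sub_cancel, Nat.add_zero, div_eq_mul_inv, mul_inv]
    ring
  · rw [← tendsto_add_atTop_iff_nat 1]
    have h := (tendsto_Dk_mul_Dk_div hγ hμ0 hμ1 hlam j k le_rfl).const_mul
      (lam * (j.factorial : ℝ) / (k.factorial : ℝ))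
    rw [mul_zero] at h
    refine h.congr fun m => ?_
    simp only [bcoef, Nat.add_sub_cancel, div_eq_mul_inv, mul_inv]
    ring
end
end

section
/- (Mehler–Heine type formula.) Suppose α = 0 and fix i = 1 (forward difference case, Sobolev inner product ⟨p,q⟩_λ = ⟨p,q⟩ + λ Δ^j p(0) Δ^j q(0)). Then, extending Q_n^{(1)} to a polynomial function on ℂ, lim_{n→∞} (μ−1)^n Q_n^{(1)}(x) / Γ(n−x) = 1 / ((1−μ)^{γ+x} Γ(−x)) for every x ∈ ℂ, uniformly on compact subsets of the complex plane, where Γ is the Gamma function, 1/Γ denotes its entire reciprocal (equal to 0 at the poles of Γ), and (1−μ)^{γ+x} = exp((γ+x) log(1−μ)) with the real logarithm of 1−μ > 0. -/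
open Finset Filter Topology Polynomial

noncomputable section

/-- The rising factorial `a(a+1)⋯(a+k−1)` in a commutative ring. -/
def rising {R : Type*} [CommRing R] (a : R) (k : ℕ) : R := ∏ m ∈ Finset.range k, (a + m)

section Rising

variable {R S : Type*} [CommRing R] [CommRing S]

@[simp] lemma rising_zero (a : R) : rising a 0 = 1 := by simp [rising]

lemma rising_succ (a : R) (k : ℕ) : rising a (k + 1) = rising a k * (a + k) := by
  simp [rising, prod_range_succ]

lemma rising_add (a : R) (k l : ℕ) : rising a (k + l) = rising a k * rising (a + k) l := by
  simp [rising, prod_range_add, add_assoc]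

lemma map_rising (f : R →+* S) (a : R) (k : ℕ) : f (rising a k) = rising (f a) k := by
  simp [rising, map_prod]

lemma rising_eq_ascPochhammer_eval (a : R) (k : ℕ) : rising a k = (ascPochhammer R k).eval a := by
  induction k with
  | zero => simp
  | succ k ih => rw [rising_succ, ih, ascPochhammer_succ_eval]

lemma rising_neg_natCast_eq_zero {i k : ℕ} (h : i < k) : rising (-(i : R)) k = 0 :=
  prod_eq_zero (mem_range.2 h) (by simp)

lemma rising_neg_natCast_add (i y : ℕ) :
    rising (-((y + i : ℕ) : R)) i * (y.factorial : R) = (-1) ^ i * ((y + i).factorial : R) := by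
  induction i with
  | zero => simp
  | succ i ih =>
    have h : rising (-((y + (i + 1) : ℕ) : R)) (i + 1)
        = -((y + (i + 1) : ℕ) : R) * rising (-((y + i : ℕ) : R)) i := by
      rw [add_comm i 1, rising_add]
      simp only [rising, prod_range_one, Nat.cast_zero, add_zero]
      congr 1
      refine prod_congr rfl fun m _ => ?_
      push_cast; ring
    rw [h, mul_assoc, ih, ← add_assoc, Nat.factorial_succ]
    push_cast; ring

end Rising

lemma rising_pos {a : ℝ} (ha : 0 < a) (k : ℕ) : 0 < rising a k :=
  prod_pos fun _ _ => by positivity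

lemma rising_nonneg {a : ℝ} (ha : 0 ≤ a) (k : ℕ) : 0 ≤ rising a k :=
  prod_nonneg fun _ _ => by positivity

lemma norm_rising_le {z : ℂ} {r : ℝ} (hz : ‖z‖ ≤ r) (k : ℕ) : ‖rising z k‖ ≤ rising r k := by
  rw [rising, norm_prod]
  refine prod_le_prod (fun _ _ => norm_nonneg _) fun m _ => ?_
  exact (norm_add_le _ _).trans (by simpa using hz)

lemma hasSum_rising {t : ℝ} (ht0 : 0 ≤ t) (ht1 : t < 1) (a : ℂ) :
    HasSum (fun k : ℕ => rising a k / (k.factorial : ℂ) * (t : ℂ) ^ k)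
      (Complex.exp (-(a * (Real.log (1 - t) : ℂ)))) := by
  have h := (Complex.one_div_one_sub_cpow_hasFPowerSeriesOnBall_zero a).hasSum
    (y := (t : ℂ)) (by
      simp only [Metric.mem_eball, edist_zero_right]
      rw [← ofReal_norm, ← ENNReal.ofReal_one, ENNReal.ofReal_lt_ofReal_iff one_pos]
      simpa [abs_of_nonneg ht0] using ht1)
  convert! h using 1
  · funext k
    rw [FormalMultilinearSeries.ofScalars_apply_eq, smul_eq_mul]
    congr 1
    rw [rising_eq_ascPochhammer_eval, div_eq_iff (by exact_mod_cast k.factorial_ne_zero),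
      mul_comm, ← nsmul_eq_mul, ← Ring.multichoose_eq,
      Ring.factorial_nsmul_multichoose_eq_ascPochhammer, Polynomial.ascPochhammer_smeval_eq_eval]
  · have h1 : (1 - (0 + t) : ℂ) = ((1 - t : ℝ) : ℂ) := by push_cast; ring
    rw [h1, Complex.cpow_def_of_ne_zero (by exact_mod_cast (sub_pos.2 ht1).ne'),
      ← Complex.ofReal_log (sub_pos.2 ht1).le, Complex.exp_neg, one_div, mul_comm a]

lemma hasSum_rising_real {t : ℝ} (ht0 : 0 ≤ t) (ht1 : t < 1) (a : ℝ) :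
    HasSum (fun k : ℕ => rising a k / (k.factorial : ℝ) * t ^ k)
      (Real.exp (-(a * Real.log (1 - t)))) := by
  rw [← Complex.hasSum_ofReal]
  convert! hasSum_rising ht0 ht1 a using 1
  · funext k
    push_cast
    rw [← Complex.ofRealHom_eq_coe, map_rising]; rfl
  · push_cast; rfl

lemma exists_rising_le (r : ℝ) {ρ : ℝ} (hρ : 1 < ρ) :
    ∃ C : ℝ, 0 < C ∧ ∀ k : ℕ, rising r k / (k.factorial : ℝ) ≤ C * ρ ^ k := by
  have h := (hasSum_rising_real (t := ρ⁻¹) (by positivity) (inv_lt_one_of_one_lt₀ hρ)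
    r).summable.tendsto_atTop_zero
  obtain ⟨C, hC⟩ := h.bddAbove_range
  refine ⟨max C 1, by positivity, fun k => ?_⟩
  have h1 := (hC ⟨k, rfl⟩).trans (le_max_left C 1)
  simp only [inv_pow] at h1
  rwa [← div_eq_mul_inv, div_le_iff₀ (by positivity)] at h1

section Functional

variable {γ μ : ℝ}

/-- The weight `μ^x (γ)_x / x!` of the Meixner inner product. -/
def meixnerWeight (γ μ : ℝ) (x : ℕ) : ℝ := μ ^ x * rising γ x / (x.factorial : ℝ)

lemma meixnerWeight_nonneg (hγ : 0 < γ) (hμ0 : 0 < μ) (x : ℕ) : 0 ≤ meixnerWeight γ μ x := by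
  have := rising_pos hγ x
  unfold meixnerWeight
  positivity

lemma summable_eval_mul_meixnerWeight (hγ : 0 < γ) (hμ0 : 0 < μ) (hμ1 : μ < 1) (p : ℝ[X]) :
    Summable fun x : ℕ => p.eval (x : ℝ) * meixnerWeight γ μ x := by
  induction p using Polynomial.induction_on' with
  | add p q hp hq => simpa [add_mul] using hp.add hq
  | monomial d a =>
    obtain ⟨ρ, hρ1, hρ2⟩ := exists_between (one_lt_inv_iff₀.2 ⟨hμ0, hμ1⟩)
    have hρ0 : 0 < ρ := one_pos.trans hρ1
    have hr : μ * ρ < 1 := by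
      rwa [lt_inv_comm₀ hρ0 hμ0, ← one_div, lt_div_iff₀ hρ0] at hρ2
    obtain ⟨C, hC, h⟩ := exists_rising_le γ hρ1
    have hs := (summable_pow_mul_geometric_of_norm_lt_one (R := ℝ) d (r := μ * ρ)
      (by rwa [Real.norm_of_nonneg (by positivity)])).mul_left (|a| * C)
    refine hs.of_norm_bounded fun x => ?_
    rw [norm_mul, Real.norm_of_nonneg (meixnerWeight_nonneg hγ hμ0 x), eval_monomial, norm_mul,
      Real.norm_of_nonneg (by positivity : (0 : ℝ) ≤ (x : ℝ) ^ d), Real.norm_eq_abs]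
    calc |a| * (x : ℝ) ^ d * meixnerWeight γ μ x
        = |a| * (x : ℝ) ^ d * μ ^ x * (rising γ x / (x.factorial : ℝ)) := by
          unfold meixnerWeight; ring
      _ ≤ |a| * (x : ℝ) ^ d * μ ^ x * (C * ρ ^ x) := by gcongr; exact h x
      _ = _ := by rw [mul_pow]; ring

/-- The moment functional `p ↦ ∑ₓ p(x) μ^x (γ)_x / x!`. -/
def meixnerFunctional (hγ : 0 < γ) (hμ0 : 0 < μ) (hμ1 : μ < 1) : ℝ[X] →ₗ[ℝ] ℝ where
  toFun p := ∑' x : ℕ, p.eval (x : ℝ) * meixnerWeight γ μ x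
  map_add' p q := by
    simp only [eval_add, add_mul]
    exact (summable_eval_mul_meixnerWeight hγ hμ0 hμ1 p).tsum_add
      (summable_eval_mul_meixnerWeight hγ hμ0 hμ1 q)
  map_smul' c p := by simp [mul_assoc, tsum_mul_left]

variable (hγ : 0 < γ) (hμ0 : 0 < μ) (hμ1 : μ < 1)

lemma meixnerFunctional_apply (p : ℝ[X]) :
    meixnerFunctional hγ hμ0 hμ1 p = ∑' x : ℕ, p.eval (x : ℝ) * meixnerWeight γ μ x := rfl

lemma mIP_eval_eq (p q : ℝ[X]) :
    mIP γ μ (fun x => p.eval x) (fun x => q.eval x) = meixnerFunctional hγ hμ0 hμ1 (p * q) := by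
  simp only [mIP, meixnerFunctional_apply, meixnerWeight, eval_mul]
  refine tsum_congr fun x => ?_
  rw [show poch γ x = rising γ x from rfl]
  ring

lemma eval_rising (a : ℝ[X]) (k : ℕ) (x : ℝ) : (rising a k).eval x = rising (a.eval x) k :=
  map_rising (Polynomial.evalRingHom x) a k

lemma meixnerFunctional_rising_neg_X_mul (i l : ℕ) (q : ℝ[X]) :
    meixnerFunctional hγ hμ0 hμ1 (rising (-X) i * rising (X + C γ) l * q)
      = (-μ) ^ i * meixnerFunctional hγ hμ0 hμ1
          (rising (X + C γ) (i + l) * q.comp (X + C (i : ℝ))) := by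
  simp only [meixnerFunctional_apply]
  rw [← (summable_eval_mul_meixnerWeight hγ hμ0 hμ1
      (rising (-X) i * rising (X + C γ) l * q)).sum_add_tsum_nat_add i,
    sum_eq_zero, zero_add, ← tsum_mul_left]
  · refine tsum_congr fun y => ?_
    have hy : (y.factorial : ℝ) ≠ 0 := by exact_mod_cast y.factorial_ne_zero
    have hyi : ((y + i).factorial : ℝ) ≠ 0 := by exact_mod_cast (y + i).factorial_ne_zero
    have h1 : rising (-((y + i : ℕ) : ℝ)) i
        = (-1) ^ i * ((y + i).factorial : ℝ) / (y.factorial : ℝ) :=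
      eq_div_of_mul_eq hy (rising_neg_natCast_add i y)
    have h2 : rising γ (y + i) * rising (((y + i : ℕ) : ℝ) + γ) l
        = rising γ y * rising ((y : ℝ) + γ) (i + l) := by
      rw [add_comm ((y + i : ℕ) : ℝ), ← rising_add, add_assoc, rising_add, add_comm γ]
    simp only [eval_mul, eval_rising, eval_neg, eval_X, eval_add, eval_C, eval_comp, meixnerWeight]
    rw [h1, ← Nat.cast_add]
    calc _ = (-1) ^ i * μ ^ (y + i) * (rising γ (y + i) * rising (((y + i : ℕ) : ℝ) + γ) l)
          * q.eval ((y + i : ℕ) : ℝ) / (y.factorial : ℝ) := by field_simp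
      _ = _ := by rw [h2, neg_pow, pow_add]; ring
  · intro x hx
    simp [eval_rising, rising_neg_natCast_eq_zero (mem_range.1 hx)]

lemma meixnerFunctional_rising (n : ℕ) :
    meixnerFunctional hγ hμ0 hμ1 (rising (X + C γ) n)
      = rising γ n * Real.exp (-((γ + n) * Real.log (1 - μ))) := by
  rw [← (hasSum_rising_real hμ0.le hμ1 (γ + n)).tsum_eq, ← tsum_mul_left, meixnerFunctional_apply]
  refine tsum_congr fun y => ?_
  have h : rising γ y * rising ((y : ℝ) + γ) n = rising γ n * rising (γ + n) y := by
    rw [add_comm (y : ℝ), ← rising_add, add_comm y, rising_add]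
  simp only [eval_rising, eval_add, eval_X, eval_C, meixnerWeight]
  linear_combination (μ ^ y / (y.factorial : ℝ)) * h

end Functional

section Orthogonality

variable {γ μ : ℝ}

lemma natDegree_rising_neg_X_le (k : ℕ) : (rising (-X : ℝ[X]) k).natDegree ≤ k := by
  refine (natDegree_prod_le _ _).trans ((sum_le_card_nsmul _ _ 1 fun m _ => ?_).trans (by simp))
  rw [neg_add_eq_sub, ← C_eq_natCast, natDegree_sub, natDegree_X_sub_C]

lemma coeff_rising_neg_X (k : ℕ) : (rising (-X : ℝ[X]) k).coeff k = (-1) ^ k := by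
  have h := coeff_prod_of_natDegree_le (range k) (fun m => (-X + (m : ℝ[X]))) 1 fun m _ => by
    rw [neg_add_eq_sub, ← C_eq_natCast, natDegree_sub, natDegree_X_sub_C]
  simpa [rising, coeff_natCast_ite] using h

lemma natDegree_rising_X_add_C_le (a : ℝ) (k : ℕ) : (rising (X + C a) k).natDegree ≤ k := by
  refine (natDegree_prod_le _ _).trans ((sum_le_card_nsmul _ _ 1 fun m _ => ?_).trans (by simp))
  rw [add_assoc, ← C_eq_natCast, ← C_add, natDegree_X_add_C]

lemma coeff_rising_X_add_C (a : ℝ) (k : ℕ) : (rising (X + C a) k).coeff k = 1 := by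
  have h := coeff_prod_of_natDegree_le (range k) (fun m => (X + C a + (m : ℝ[X]))) 1 fun m _ => by
    rw [add_assoc, ← C_eq_natCast, ← C_add, natDegree_X_add_C]
  simpa [rising, coeff_natCast_ite, coeff_C] using h

/-- The Meixner polynomial of degree `n`, normalized to have leading coefficient `(μ - 1) ^ n`. -/
def meixnerPoly (γ μ : ℝ) (n : ℕ) : ℝ[X] :=
  ∑ k ∈ range (n + 1), C ((n.choose k : ℝ) * μ ^ k) * (rising (-X) (n - k) * rising (X + C γ) k)

lemma natDegree_rising_mul_rising_le {n k : ℕ} (hk : k ≤ n) :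
    (rising (-X) (n - k) * rising (X + C γ) k).natDegree ≤ n := by
  refine natDegree_mul_le.trans ?_
  have h1 := natDegree_rising_neg_X_le (n - k)
  have h2 := natDegree_rising_X_add_C_le γ k
  omega

lemma natDegree_meixnerPoly_le (n : ℕ) : (meixnerPoly γ μ n).natDegree ≤ n :=
  natDegree_sum_le_of_forall_le _ _ fun _ hk =>
    (natDegree_C_mul_le _ _).trans
      (natDegree_rising_mul_rising_le (Nat.lt_succ_iff.1 (mem_range.1 hk)))

lemma coeff_meixnerPoly (n : ℕ) : (meixnerPoly γ μ n).coeff n = (μ - 1) ^ n := by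
  rw [sub_eq_add_neg, add_pow, meixnerPoly, finsetSum_coeff]
  refine sum_congr rfl fun k hk => ?_
  have hk : k ≤ n := Nat.lt_succ_iff.1 (mem_range.1 hk)
  have h := coeff_mul_add_eq_of_natDegree_le (natDegree_rising_neg_X_le (n - k))
    (natDegree_rising_X_add_C_le γ k)
  rw [Nat.sub_add_cancel hk, coeff_rising_neg_X, coeff_rising_X_add_C] at h
  rw [coeff_C_mul, h]
  ring

lemma fwdDiff_iter_eval_of_natDegree_le {q : ℝ[X]} {n : ℕ} (hq : q.natDegree ≤ n) (y : ℝ) :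
    (fwdDiff 1)^[n] q.eval y = (n.factorial : ℝ) * q.coeff n := by
  rcases hq.lt_or_eq with h | h
  · rw [Polynomial.fwdDiff_iter_eq_zero_of_degree_lt h, coeff_eq_zero_of_natDegree_lt h]
    simp
  · subst h
    rw [Polynomial.fwdDiff_iter_degree_eq_factorial]
    simp [mul_comm]

lemma sum_choose_mul_comp_eq {q : ℝ[X]} {n : ℕ} (hq : q.natDegree ≤ n) :
    ∑ k ∈ range (n + 1), C ((n.choose k : ℝ) * (-1) ^ (n - k)) * q.comp (X + C ((n - k : ℕ) : ℝ))
      = C ((-1) ^ n * ((n.factorial : ℝ) * q.coeff n)) := by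
  refine Polynomial.funext fun y => ?_
  rw [eval_C, ← fwdDiff_iter_eval_of_natDegree_le hq y, fwdDiff_iter_eq_sum_shift, eval_finsetSum,
    mul_sum, ← sum_flip]
  refine sum_congr rfl fun k hk => ?_
  have hk : k ≤ n := Nat.lt_succ_iff.1 (mem_range.1 hk)
  have h : ((-1 : ℝ) ^ k) = (-1) ^ n * (-1) ^ (n - k) := by
    obtain ⟨m, rfl⟩ := Nat.exists_eq_add_of_le hk
    rw [Nat.add_sub_cancel_left, pow_add, mul_assoc, ← mul_pow]
    simp
  simp only [eval_mul, eval_C, eval_comp, eval_add, eval_X, Nat.choose_symm hk,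
    Nat.sub_sub_self hk, h, zsmul_eq_mul, nsmul_eq_mul, mul_one]
  push_cast
  ring

/-- The squared norm of `meixnerPoly γ μ n`. -/
def meixnerNormSq (γ μ : ℝ) (n : ℕ) : ℝ :=
  (n.factorial : ℝ) * (μ ^ n * rising γ n) * Real.exp (-(γ * Real.log (1 - μ)))

lemma meixnerNormSq_pos (hγ : 0 < γ) (hμ0 : 0 < μ) (n : ℕ) : 0 < meixnerNormSq γ μ n := by
  have := rising_pos hγ n
  unfold meixnerNormSq
  positivity

variable (hγ : 0 < γ) (hμ0 : 0 < μ) (hμ1 : μ < 1)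

lemma meixnerFunctional_meixnerPoly_mul {n : ℕ} {q : ℝ[X]} (hq : q.natDegree ≤ n) :
    meixnerFunctional hγ hμ0 hμ1 (meixnerPoly γ μ n * q)
      = q.coeff n / (μ - 1) ^ n * meixnerNormSq γ μ n := by
  have h1 : meixnerFunctional hγ hμ0 hμ1 (meixnerPoly γ μ n * q)
      = μ ^ n * meixnerFunctional hγ hμ0 hμ1 (rising (X + C γ) n *
        ∑ k ∈ range (n + 1), C ((n.choose k : ℝ) * (-1) ^ (n - k)) *
          q.comp (X + C ((n - k : ℕ) : ℝ))) := by
    rw [meixnerPoly, sum_mul, mul_sum, map_sum, map_sum, mul_sum]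
    refine sum_congr rfl fun k hk => ?_
    have hk : k ≤ n := Nat.lt_succ_iff.1 (mem_range.1 hk)
    rw [mul_assoc, ← smul_eq_C_mul, map_smul, meixnerFunctional_rising_neg_X_mul,
      Nat.sub_add_cancel hk, mul_left_comm, ← smul_eq_C_mul, map_smul, smul_eq_mul, smul_eq_mul,
      neg_pow μ, ← Nat.sub_add_cancel hk, pow_add μ (n - k) k]
    simp only [Nat.add_sub_cancel]
    ring
  have hμ : 1 - μ ≠ 0 := (sub_pos.2 hμ1).ne'
  have h2 : Real.exp (-((γ + n) * Real.log (1 - μ)))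
      = Real.exp (-(γ * Real.log (1 - μ))) * ((1 - μ) ^ n)⁻¹ := by
    rw [← Real.exp_log (pow_pos (sub_pos.2 hμ1) n), Real.log_pow, ← Real.exp_neg, ← Real.exp_add]
    ring_nf
  rw [h1, sum_choose_mul_comp_eq hq, mul_comm (rising _ _), ← smul_eq_C_mul, map_smul,
    meixnerFunctional_rising, smul_eq_mul, h2, meixnerNormSq, ← neg_sub 1 μ, neg_pow (1 - μ)]
  have h3 : ((-1 : ℝ) ^ n)⁻¹ = (-1) ^ n := by rw [← inv_pow]; norm_num
  rw [div_eq_mul_inv, mul_inv, h3]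
  ring

lemma eq_zero_of_orthogonal {n : ℕ} {s : ℝ[X]} (hs : s.degree < n)
    (h : ∀ k < n, meixnerFunctional hγ hμ0 hμ1 (meixnerPoly γ μ k * s) = 0) : s = 0 := by
  by_contra h0
  have hd : s.natDegree < n := (natDegree_lt_iff_degree_lt h0).2 hs
  have := h _ hd
  rw [meixnerFunctional_meixnerPoly_mul hγ hμ0 hμ1 le_rfl] at this
  have h1 := (meixnerNormSq_pos hγ hμ0 s.natDegree).ne'
  have h2 : (μ - 1) ^ s.natDegree ≠ 0 := pow_ne_zero _ (sub_neg.2 hμ1).ne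
  simp_all

/-- The functional `p ↦ Δ^j p(0)`. -/
def fwdDiffZero (j : ℕ) : ℝ[X] →ₗ[ℝ] ℝ where
  toFun p := (fwdDiff 1)^[j] (fun x => p.eval x) 0
  map_add' p q := by
    simp only [eval_add]
    exact congrFun (fwdDiff_iter_add 1 (fun x => p.eval x) (fun x => q.eval x) j) 0
  map_smul' c p := by
    simp only [eval_smul]
    exact congrFun (fwdDiff_iter_const_smul 1 c (fun x => p.eval x) j) 0

lemma Dk_eval_zero (j : ℕ) (p : ℝ[X]) : Dk 1 j (fun x => p.eval x) 0 = fwdDiffZero j p := by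
  have h : Dop 1 = fwdDiff (1 : ℝ) := by
    funext f x
    simp [Dop, fwdDiff]
  rw [Dk, h]
  rfl

lemma abs_fwdDiffZero_le (j : ℕ) (p : ℝ[X]) :
    |fwdDiffZero j p| ≤ ∑ i ∈ range (j + 1), (j.choose i : ℝ) * |p.eval (i : ℝ)| := by
  change |(fwdDiff 1)^[j] (fun x => p.eval x) 0| ≤ _
  rw [fwdDiff_iter_eq_sum_shift]
  refine (abs_sum_le_sum_abs _ _).trans (sum_le_sum fun i _ => ?_)
  simp [abs_mul]

end Orthogonality

section SobolevDecomposition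

variable {γ μ lam : ℝ} {j n : ℕ} {Q : ℝ[X]}

lemma IsSobolevOP.smul_eq (hγ : 0 < γ) (hμ0 : 0 < μ) (hμ1 : μ < 1)
    (hQ : IsSobolevOP γ μ lam 0 1 j n Q) :
    (μ - 1) ^ n • Q = meixnerPoly γ μ n - (lam * fwdDiffZero j ((μ - 1) ^ n • Q)) •
      ∑ k ∈ range n, (fwdDiffZero j (meixnerPoly γ μ k) / meixnerNormSq γ μ k) •
        meixnerPoly γ μ k := by
  obtain ⟨hmon, hdeg, horth⟩ := hQ
  set q := (μ - 1) ^ n • Q with hq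
  set c := lam * fwdDiffZero j q with hc
  rw [← sub_eq_zero]
  have hqorth : ∀ p : ℝ[X], p.degree < n →
      meixnerFunctional hγ hμ0 hμ1 (p * q) = -(c * fwdDiffZero j p) := by
    intro p hp
    have h := horth p hp
    rw [sIP, mIP_eval_eq hγ hμ0 hμ1, Dk_eval_zero, Dk_eval_zero] at h
    rw [hc, hq, mul_smul_comm, mul_comm p, map_smul, map_smul, smul_eq_mul, smul_eq_mul]
    linear_combination (μ - 1) ^ n * h
  have hlt : ∀ k < n, (meixnerPoly γ μ k).degree < n := fun k hk =>
    (degree_le_of_natDegree_le (natDegree_meixnerPoly_le k)).trans_lt (by exact_mod_cast hk)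
  have hself : ∀ k, meixnerFunctional hγ hμ0 hμ1 (meixnerPoly γ μ k * meixnerPoly γ μ k)
      = meixnerNormSq γ μ k := fun k => by
    rw [meixnerFunctional_meixnerPoly_mul hγ hμ0 hμ1 (natDegree_meixnerPoly_le k),
      coeff_meixnerPoly, div_self (pow_ne_zero _ (sub_neg.2 hμ1).ne), one_mul]
  have hne : ∀ k l, k < l →
      meixnerFunctional hγ hμ0 hμ1 (meixnerPoly γ μ l * meixnerPoly γ μ k) = 0 := fun k l hkl => by
    have h := (natDegree_meixnerPoly_le (γ := γ) (μ := μ) k).trans_lt hkl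
    rw [meixnerFunctional_meixnerPoly_mul hγ hμ0 hμ1 h.le, coeff_eq_zero_of_natDegree_lt h]
    simp
  refine eq_zero_of_orthogonal hγ hμ0 hμ1 (n := n) ?_ fun k hk => ?_
  · rw [sub_sub_eq_add_sub, add_sub_right_comm]
    refine (degree_add_le _ _).trans_lt (max_lt ?_ ((degree_smul_le _ _).trans_lt ?_))
    · rw [degree_lt_iff_coeff_zero]
      intro m hm
      rcases hm.lt_or_eq with hm | rfl
      · rw [coeff_sub, hq, coeff_smul, coeff_eq_zero_of_natDegree_lt (hdeg.trans_lt hm),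
          coeff_eq_zero_of_natDegree_lt ((natDegree_meixnerPoly_le n).trans_lt hm)]
        simp
      · have h1 : Q.coeff n = 1 := hdeg ▸ hmon
        rw [coeff_sub, hq, coeff_smul, coeff_meixnerPoly, h1]
        simp
    · exact (degree_sum_le _ _).trans_lt ((Finset.sup_lt_iff (WithBot.bot_lt_coe n)).2
        fun k hk => (degree_smul_le _ _).trans_lt (hlt k (mem_range.1 hk)))
  · have hsum : meixnerFunctional hγ hμ0 hμ1 (meixnerPoly γ μ k * ∑ i ∈ range n,
        (fwdDiffZero j (meixnerPoly γ μ i) / meixnerNormSq γ μ i) • meixnerPoly γ μ i)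
        = fwdDiffZero j (meixnerPoly γ μ k) := by
      rw [mul_sum, map_sum, sum_eq_single_of_mem k (mem_range.2 hk)]
      · rw [mul_smul_comm, map_smul, hself, smul_eq_mul,
          div_mul_cancel₀ _ (meixnerNormSq_pos hγ hμ0 k).ne']
      · intro i _ hik
        rw [mul_smul_comm, map_smul]
        rcases lt_or_gt_of_ne hik with h | h
        · rw [hne _ _ h, smul_zero]
        · rw [mul_comm, hne _ _ h, smul_zero]
    rw [mul_sub, mul_sub, map_sub, map_sub, hqorth _ (hlt k hk), mul_comm _ (meixnerPoly γ μ n),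
      hne _ _ hk, mul_smul_comm, map_smul, hsum, smul_eq_mul]
    ring

lemma IsSobolevOP.abs_fwdDiffZero_le (hγ : 0 < γ) (hμ0 : 0 < μ) (hμ1 : μ < 1) (hlam : 0 < lam)
    (hQ : IsSobolevOP γ μ lam 0 1 j n Q) :
    |fwdDiffZero j ((μ - 1) ^ n • Q)| ≤ |fwdDiffZero j (meixnerPoly γ μ n)| := by
  have h := hQ.smul_eq hγ hμ0 hμ1
  generalize (μ - 1) ^ n • Q = q at h ⊢
  replace h := congrArg (fwdDiffZero j) h
  rw [map_sub, map_smul, map_sum] at h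
  set d := fwdDiffZero j q
  have hS : 0 ≤ ∑ k ∈ range n, fwdDiffZero j
      ((fwdDiffZero j (meixnerPoly γ μ k) / meixnerNormSq γ μ k) • meixnerPoly γ μ k) := by
    refine sum_nonneg fun k _ => ?_
    rw [map_smul, smul_eq_mul, div_mul_eq_mul_div]
    exact div_nonneg (mul_self_nonneg _) (meixnerNormSq_pos hγ hμ0 k).le
  set S := ∑ k ∈ range n, fwdDiffZero j
      ((fwdDiffZero j (meixnerPoly γ μ k) / meixnerNormSq γ μ k) • meixnerPoly γ μ k)
  have h' : fwdDiffZero j (meixnerPoly γ μ n) = d * (1 + lam * S) := by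
    rw [smul_eq_mul] at h
    linear_combination -h
  rw [h', abs_mul]
  have : 0 ≤ lam * S := by positivity
  exact le_mul_of_one_le_right (abs_nonneg _) (by rw [abs_of_nonneg] <;> linarith)

end SobolevDecomposition

section Asymptotics

/-- The ratio `(-x)_m (m+k)! / (m! Γ(m+k-x))`. -/
def gammaRatio (m k : ℕ) (x : ℂ) : ℂ :=
  rising (-x) m / (m.factorial : ℂ) *
    (((m + k).factorial : ℂ) * (Complex.Gamma (((m + k : ℕ) : ℂ) - x))⁻¹)

lemma rising_neg_mul_inv_Gamma (m : ℕ) (x : ℂ) :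
    rising (-x) m * (Complex.Gamma ((m : ℂ) - x))⁻¹ = (Complex.Gamma (-x))⁻¹ := by
  induction m with
  | zero => simp
  | succ m ih =>
    rw [← ih, Complex.one_div_Gamma_eq_self_mul_one_div_Gamma_add_one ((m : ℂ) - x), rising_succ,
      Nat.cast_succ, sub_add_eq_add_sub]
    ring

lemma gammaRatio_zero_right (m : ℕ) (x : ℂ) : gammaRatio m 0 x = (Complex.Gamma (-x))⁻¹ := by
  have hm : (m.factorial : ℂ) ≠ 0 := by exact_mod_cast m.factorial_ne_zero
  rw [← rising_neg_mul_inv_Gamma m, gammaRatio, add_zero]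
  field_simp

lemma gammaRatio_zero_left (k : ℕ) (x : ℂ) :
    gammaRatio 0 k x = (k.factorial : ℂ) * (Complex.Gamma ((k : ℂ) - x))⁻¹ := by
  simp [gammaRatio]

lemma gammaRatio_succ {m k : ℕ} {x : ℂ} (h : ((m + k : ℕ) : ℂ) - x ≠ 0) :
    gammaRatio m (k + 1) x
      = gammaRatio m k x * ((((m + k : ℕ) : ℂ) + 1) / (((m + k : ℕ) : ℂ) - x)) := by
  rw [gammaRatio, gammaRatio, Complex.one_div_Gamma_eq_self_mul_one_div_Gamma_add_one
    (((m + k : ℕ) : ℂ) - x), ← add_assoc, Nat.factorial_succ, Nat.cast_succ, sub_add_eq_add_sub,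
    Nat.cast_mul, Nat.cast_succ]
  field_simp

lemma continuous_gammaRatio (m k : ℕ) : Continuous (gammaRatio m k) := by
  have h := Complex.differentiable_one_div_Gamma.continuous
  have h1 : Continuous fun x : ℂ => rising (-x) m := by
    unfold rising
    fun_prop
  unfold gammaRatio
  exact (h1.div_const _).mul (continuous_const.mul (h.comp (by fun_prop)))

lemma sub_le_norm_natCast_sub {x : ℂ} {R : ℝ} (hx : ‖x‖ ≤ R) (n : ℕ) :
    (n : ℝ) - R ≤ ‖(n : ℂ) - x‖ := by
  have h := norm_sub_norm_le (n : ℂ) x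
  rw [Complex.norm_natCast] at h
  linarith

lemma exists_gammaRatio_le {K : Set ℂ} (hK : IsCompact K) {ρ : ℝ} (hρ : 1 < ρ) :
    ∃ C : ℝ, 0 < C ∧ ∀ m k : ℕ, ∀ x ∈ K, ‖gammaRatio m k x‖ ≤ C * ρ ^ k := by
  obtain ⟨R, hR⟩ := hK.isBounded.exists_norm_le
  obtain ⟨M, hM⟩ := exists_nat_ge ((1 + ρ * R) / (ρ - 1))
  rw [div_le_iff₀ (sub_pos.2 hρ)] at hM
  choose B hB using fun m k =>
    hK.exists_bound_of_continuousOn (continuous_gammaRatio m k).continuousOn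
  set C : ℝ := 1 + ∑ m ∈ range (M + 1), ∑ k ∈ range (M + 1), |B m k| with hC
  have hBC : ∀ m ≤ M, ∀ k ≤ M, B m k ≤ C := by
    intro m hm k hk
    have h1 : |B m k| ≤ ∑ k ∈ range (M + 1), |B m k| :=
      single_le_sum (f := fun k => |B m k|) (fun _ _ => abs_nonneg _)
        (mem_range.2 (Nat.lt_succ_of_le hk))
    have h2 : ∑ k ∈ range (M + 1), |B m k|
        ≤ ∑ m ∈ range (M + 1), ∑ k ∈ range (M + 1), |B m k| :=
      single_le_sum (f := fun m => ∑ k ∈ range (M + 1), |B m k|)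
        (fun _ _ => sum_nonneg fun _ _ => abs_nonneg _) (mem_range.2 (Nat.lt_succ_of_le hm))
    linarith [le_abs_self (B m k)]
  have hC0 : 0 < C := by positivity
  refine ⟨C, hC0, fun m k x hx => ?_⟩
  induction k with
  | zero =>
    rw [gammaRatio_zero_right, ← gammaRatio_zero_right 0, pow_zero, mul_one]
    exact (hB 0 0 x hx).trans (hBC 0 M.zero_le 0 M.zero_le)
  | succ k ih =>
    rcases le_or_gt M (m + k) with h | h
    · have h1 := sub_le_norm_natCast_sub (hR x hx) (m + k)
      have hMk : (M : ℝ) ≤ ((m + k : ℕ) : ℝ) := by exact_mod_cast h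
      have h2 : ((m + k : ℕ) : ℝ) + 1 ≤ ρ * (((m + k : ℕ) : ℝ) - R) := by nlinarith
      have h3 : 0 < ((m + k : ℕ) : ℝ) - R := by
        have h4 : 0 < ρ * (((m + k : ℕ) : ℝ) - R) := lt_of_lt_of_le (by positivity) h2
        exact pos_of_mul_pos_right h4 (by linarith)
      have h4 : 0 < ‖((m + k : ℕ) : ℂ) - x‖ := h3.trans_le h1
      have h5 : ‖((m + k : ℕ) : ℂ) + 1‖ = ((m + k : ℕ) : ℝ) + 1 := by
        rw [← Nat.cast_succ, Complex.norm_natCast, Nat.cast_succ]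
      rw [gammaRatio_succ (norm_pos_iff.1 h4), norm_mul, norm_div, pow_succ, ← mul_assoc]
      gcongr
      rw [div_le_iff₀ h4, h5]
      exact h2.trans (by gcongr)
    · refine (hB m (k + 1) x hx).trans ((hBC m (by omega) (k + 1) (by omega)).trans ?_)
      exact le_mul_of_one_le_right hC0.le (one_le_pow₀ hρ.le)

lemma eventually_prod_principal {K : Set ℂ} {p : ℕ × ℂ → Prop} (N : ℕ)
    (h : ∀ n ≥ N, ∀ x ∈ K, p (n, x)) : ∀ᶠ q in atTop ×ˢ 𝓟 K, p q := by
  filter_upwards [prod_mem_prod (Ici_mem_atTop N) (mem_principal_self K)] with q hq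
  exact h q.1 hq.1 q.2 hq.2

lemma tendsto_gammaRatio_sub {K : Set ℂ} (hK : IsCompact K) (k : ℕ) :
    Tendsto (fun q : ℕ × ℂ => gammaRatio q.1 k q.2 - (Complex.Gamma (-q.2))⁻¹)
      (atTop ×ˢ 𝓟 K) (𝓝 0) := by
  obtain ⟨R, hR⟩ := hK.isBounded.exists_norm_le
  obtain ⟨C, hC, hbd⟩ := exists_gammaRatio_le hK one_lt_two
  induction k with
  | zero => simpa [gammaRatio_zero_right] using tendsto_const_nhds
  | succ k ih =>
    have h0 : Tendsto (fun q : ℕ × ℂ => C * 2 ^ k * ((1 + R) / ((q.1 : ℝ) - R)))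
        (atTop ×ˢ 𝓟 K) (𝓝 0) := by
      have h1 : Tendsto (fun n : ℕ => C * 2 ^ k * ((1 + R) / ((n : ℝ) - R))) atTop (𝓝 0) := by
        have h2 := (tendsto_atTop_add_const_right atTop (-R)
          (tendsto_natCast_atTop_atTop (R := ℝ))).const_div_atTop (1 + R)
        simpa [sub_eq_add_neg] using h2.const_mul (C * 2 ^ k)
      exact h1.comp tendsto_fst
    have h1 : Tendsto (fun q : ℕ × ℂ => gammaRatio q.1 k q.2 *
        ((((q.1 + k : ℕ) : ℂ) + 1) / (((q.1 + k : ℕ) : ℂ) - q.2) - 1))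
        (atTop ×ˢ 𝓟 K) (𝓝 0) := by
      obtain ⟨N, hN⟩ := exists_nat_gt R
      refine squeeze_zero_norm' (eventually_prod_principal N fun n hn x hx => ?_) h0
      have hnR : 0 < (n : ℝ) - R := sub_pos.2 (hN.trans_le (by exact_mod_cast hn))
      have h2 : (n : ℝ) - R ≤ ‖((n + k : ℕ) : ℂ) - x‖ :=
        le_trans (by simp) (sub_le_norm_natCast_sub (hR x hx) (n + k))
      have h3 : ((n + k : ℕ) : ℂ) - x ≠ 0 := norm_pos_iff.1 (hnR.trans_le h2)
      have h4 : (((n + k : ℕ) : ℂ) + 1) / (((n + k : ℕ) : ℂ) - x) - 1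
          = (1 + x) / (((n + k : ℕ) : ℂ) - x) := by
        field_simp
        ring
      have h5 : ‖1 + x‖ ≤ 1 + R := (norm_add_le _ _).trans (by simpa using hR x hx)
      have h6 : 0 ≤ 1 + R := (norm_nonneg _).trans h5
      dsimp only
      rw [h4, norm_mul, norm_div]
      gcongr
      exact hbd n k x hx
    have h2 := ih.add h1
    rw [add_zero] at h2
    obtain ⟨N, hN⟩ := exists_nat_gt R
    refine h2.congr' (eventually_prod_principal N fun n hn x hx => ?_)
    have hnR : 0 < (n : ℝ) - R := sub_pos.2 (hN.trans_le (by exact_mod_cast hn))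
    have h3 : ((n + k : ℕ) : ℂ) - x ≠ 0 := norm_pos_iff.1 (hnR.trans_le
      (le_trans (by simp) (sub_le_norm_natCast_sub (hR x hx) (n + k))))
    dsimp only
    rw [gammaRatio_succ h3]
    ring

lemma exists_one_lt_mul_pow_lt_one {μ : ℝ} (hμ1 : μ < 1) (m : ℕ) :
    ∃ ρ : ℝ, 1 < ρ ∧ μ * ρ ^ m < 1 := by
  have h : Tendsto (fun ρ : ℝ => μ * ρ ^ m) (𝓝[>] 1) (𝓝 (μ * 1 ^ m)) :=
    ((continuous_const.mul (continuous_pow m)).tendsto 1).mono_left nhdsWithin_le_nhds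
  have h1 := h.eventually_lt_const (by simpa using hμ1)
  exact ((eventually_mem_nhdsWithin (a := (1 : ℝ)) (s := Set.Ioi 1)).and h1).exists

variable {γ μ : ℝ}

lemma map_meixnerPoly {R : Type*} [CommRing R] (f : ℝ[X] →+* R) (n : ℕ) :
    f (meixnerPoly γ μ n) = ∑ k ∈ range (n + 1), (n.choose k : R) * f (C μ) ^ k *
      (rising (-f X) (n - k) * rising (f X + f (C γ)) k) := by
  simp [meixnerPoly, map_rising]

lemma map_meixnerPoly_eq_factorial_mul {R : Type*} [Field R] [CharZero R] (f : ℝ[X] →+* R) (n : ℕ) :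
    f (meixnerPoly γ μ n) = (n.factorial : R) * ∑ k ∈ range (n + 1),
      rising (-f X) (n - k) / ((n - k).factorial : R) *
        (rising (f X + f (C γ)) k / (k.factorial : R) * f (C μ) ^ k) := by
  rw [map_meixnerPoly, mul_sum]
  refine sum_congr rfl fun k hk => ?_
  rw [Nat.cast_choose R (Nat.lt_succ_iff.1 (mem_range.1 hk))]
  ring

lemma aeval_meixnerPoly (n : ℕ) (x : ℂ) :
    aeval x (meixnerPoly γ μ n) = (n.factorial : ℂ) * ∑ k ∈ range (n + 1),
      rising (-x) (n - k) / ((n - k).factorial : ℂ) *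
        (rising (x + γ) k / (k.factorial : ℂ) * (μ : ℂ) ^ k) := by
  simpa using map_meixnerPoly_eq_factorial_mul (γ := γ) (μ := μ)
    (aeval x : ℝ[X] →ₐ[ℝ] ℂ).toRingHom n

lemma aeval_meixnerPoly_mul_inv_Gamma (n : ℕ) (x : ℂ) :
    aeval x (meixnerPoly γ μ n) * (Complex.Gamma ((n : ℂ) - x))⁻¹ =
      ∑ k ∈ range (n + 1), gammaRatio (n - k) k x *
        (rising (x + γ) k / (k.factorial : ℂ) * (μ : ℂ) ^ k) := by
  rw [aeval_meixnerPoly, mul_sum, sum_mul]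
  refine sum_congr rfl fun k hk => ?_
  rw [gammaRatio, Nat.sub_add_cancel (Nat.lt_succ_iff.1 (mem_range.1 hk))]
  ring

lemma norm_rising_div_factorial (z : ℂ) (k : ℕ) :
    ‖rising z k / (k.factorial : ℂ)‖ = ‖rising z k‖ / (k.factorial : ℝ) := by
  rw [norm_div, Complex.norm_natCast]

lemma exists_norm_rising_le {K : Set ℂ} (hK : IsCompact K) {ρ : ℝ} (hρ : 1 < ρ) :
    ∃ C : ℝ, 0 < C ∧ ∀ k : ℕ, ∀ x ∈ K, ‖rising x k / (k.factorial : ℂ)‖ ≤ C * ρ ^ k := by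
  obtain ⟨R, hR⟩ := hK.isBounded.exists_norm_le
  obtain ⟨C, hC, h⟩ := exists_rising_le R hρ
  refine ⟨C, hC, fun k x hx => le_trans ?_ (h k)⟩
  rw [norm_rising_div_factorial]
  gcongr
  exact norm_rising_le (hR x hx) k

/-- The Mehler–Heine formula for Meixner polynomials. -/
lemma tendstoUniformlyOn_meixnerPoly (hμ0 : 0 < μ) (hμ1 : μ < 1) {K : Set ℂ}
    (hK : IsCompact K) :
    TendstoUniformlyOn
      (fun (n : ℕ) (x : ℂ) => aeval x (meixnerPoly γ μ n) * (Complex.Gamma ((n : ℂ) - x))⁻¹)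
      (fun x => (Complex.Gamma (-x))⁻¹ * Complex.exp (-((x + γ) * (Real.log (1 - μ) : ℂ))))
      atTop K := by
  obtain ⟨ρ, hρ, hρμ⟩ := exists_one_lt_mul_pow_lt_one hμ1 2
  obtain ⟨C₁, hC₁, hc⟩ := exists_gammaRatio_le hK hρ
  obtain ⟨C₂, hC₂, hv'⟩ := exists_norm_rising_le (hK.image (continuous_add_const (γ : ℂ))) hρ
  set v : ℕ → ℂ → ℂ := fun k x => rising (x + γ) k / (k.factorial : ℂ) * (μ : ℂ) ^ k
  have hv : ∀ k, ∀ x ∈ K, ‖v k x‖ ≤ C₂ * ρ ^ k * μ ^ k := by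
    intro k x hx
    rw [norm_mul, norm_pow, Complex.norm_of_nonneg hμ0.le]
    gcongr
    exact hv' k _ ⟨x, hx, rfl⟩
  set f : ℕ × ℂ → ℕ → ℂ := fun q k =>
    (if k ∈ range (q.1 + 1) then gammaRatio (q.1 - k) k q.2 * v k q.2 else 0)
      - (Complex.Gamma (-q.2))⁻¹ * v k q.2
  have hsum : Tendsto (fun q : ℕ × ℂ => ∑' k, f q k) (atTop ×ˢ 𝓟 K) (𝓝 (∑' _ : ℕ, 0)) := by
    refine tendsto_tsum_of_dominated_convergence
      (bound := fun k => 2 * C₁ * C₂ * (μ * ρ ^ 2) ^ k)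
      ((summable_geometric_of_lt_one (by positivity) hρμ).mul_left _) (fun k => ?_)
      (eventually_prod_principal 0 fun n _ x hx k => ?_)
    · have h1 : Tendsto (fun q : ℕ × ℂ => (q.1 - k, q.2)) (atTop ×ˢ 𝓟 K) (atTop ×ˢ 𝓟 K) :=
        ((tendsto_sub_atTop_nat k).comp tendsto_fst).prodMk tendsto_snd
      have h2 := ((tendsto_gammaRatio_sub hK k).comp h1).norm.mul_const (C₂ * ρ ^ k * μ ^ k)
      rw [norm_zero, zero_mul] at h2
      refine squeeze_zero_norm' (eventually_prod_principal k fun n hn x hx => ?_) h2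
      simp only [f, Function.comp, if_pos (mem_range.2 (Nat.lt_succ_of_le hn))]
      rw [← sub_mul, norm_mul]
      gcongr
      exact hv k x hx
    · have h1 : ‖(Complex.Gamma (-x))⁻¹‖ ≤ C₁ * ρ ^ k := by
        rw [← gammaRatio_zero_right 0]
        refine (hc 0 0 x hx).trans ?_
        gcongr
        · exact hρ.le
        · exact k.zero_le
      have h2 : ‖(if k ∈ range (n + 1) then gammaRatio (n - k) k x * v k x else 0)‖
          ≤ C₁ * ρ ^ k * (C₂ * ρ ^ k * μ ^ k) := by
        split_ifs
        · rw [norm_mul]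
          gcongr
          · exact hc _ k x hx
          · exact hv k x hx
        · rw [norm_zero]; positivity
      have h3 : ‖(Complex.Gamma (-x))⁻¹ * v k x‖ ≤ C₁ * ρ ^ k * (C₂ * ρ ^ k * μ ^ k) := by
        rw [norm_mul]
        gcongr
        exact hv k x hx
      refine (norm_sub_le _ _).trans ((add_le_add h2 h3).trans (le_of_eq ?_))
      rw [mul_pow, ← pow_mul]
      ring
  have hf : ∀ q : ℕ × ℂ, ∑' k, f q k =
      aeval q.2 (meixnerPoly γ μ q.1) * (Complex.Gamma ((q.1 : ℂ) - q.2))⁻¹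
        - (Complex.Gamma (-q.2))⁻¹ * Complex.exp (-((q.2 + γ) * (Real.log (1 - μ) : ℂ))) := by
    intro q
    rw [aeval_meixnerPoly_mul_inv_Gamma]
    refine HasSum.tsum_eq (HasSum.sub ?_ ((hasSum_rising hμ0.le hμ1 (q.2 + γ)).mul_left _))
    have h := hasSum_sum_of_ne_finset_zero (L := .unconditional ℕ) (s := range (q.1 + 1))
      (f := fun k => if k ∈ range (q.1 + 1) then gammaRatio (q.1 - k) k q.2 * v k q.2 else 0)
      fun k hk => if_neg hk
    rwa [sum_congr rfl fun k hk => if_pos hk] at h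
  rw [tsum_zero] at hsum
  rw [tendstoUniformlyOn_iff_tendsto, uniformity_eq_comap_nhds_zero, tendsto_comap_iff]
  exact hsum.congr hf

lemma exists_norm_aeval_meixnerPoly_le (hμ0 : 0 < μ) (hμ1 : μ < 1) {K : Set ℂ}
    (hK : IsCompact K) {ρ : ℝ} (hρ : 1 < ρ) :
    ∃ C : ℝ, 0 < C ∧ ∀ n : ℕ, ∀ x ∈ K,
      ‖aeval x (meixnerPoly γ μ n)‖ ≤ (n.factorial : ℝ) * (C * ρ ^ n) := by
  obtain ⟨C₁, hC₁, h₁⟩ := exists_norm_rising_le (hK.image continuous_neg) hρ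
  obtain ⟨C₂, hC₂, h₂⟩ := exists_norm_rising_le (hK.image (continuous_add_const (γ : ℂ))) hρ
  have hμ : 0 < 1 - μ := sub_pos.2 hμ1
  refine ⟨C₁ * C₂ * (1 - μ)⁻¹, by positivity, fun n x hx => ?_⟩
  rw [aeval_meixnerPoly, norm_mul, Complex.norm_natCast]
  gcongr
  calc _ ≤ ∑ k ∈ range (n + 1), C₁ * C₂ * ρ ^ n * μ ^ k := by
        refine norm_sum_le_of_le _ fun k hk => ?_
        have hk : k ≤ n := Nat.lt_succ_iff.1 (mem_range.1 hk)
        rw [norm_mul, norm_mul, norm_pow, Complex.norm_of_nonneg hμ0.le]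
        calc _ ≤ C₁ * ρ ^ (n - k) * (C₂ * ρ ^ k * μ ^ k) := by
              gcongr
              · exact h₁ _ _ ⟨x, hx, rfl⟩
              · exact h₂ _ _ ⟨x, hx, rfl⟩
          _ = C₁ * C₂ * (ρ ^ (n - k) * ρ ^ k) * μ ^ k := by ring
          _ = _ := by rw [← pow_add, Nat.sub_add_cancel hk]
    _ = C₁ * C₂ * ρ ^ n * ∑ k ∈ range (n + 1), μ ^ k := by rw [mul_sum]
    _ ≤ C₁ * C₂ * ρ ^ n * (1 - μ)⁻¹ := by
        gcongr
        rw [← tsum_geometric_of_lt_one hμ0.le hμ1]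
        exact (summable_geometric_of_lt_one hμ0.le hμ1).sum_le_tsum _ fun _ _ => by positivity
    _ = _ := by ring

lemma exists_abs_eval_natCast_meixnerPoly_le (hγ : 0 < γ) (hμ0 : 0 < μ) (i : ℕ) {ρ : ℝ}
    (hρ : 1 < ρ) :
    ∃ C : ℝ, 0 < C ∧ ∀ n : ℕ,
      |(meixnerPoly γ μ n).eval (i : ℝ)| ≤ (n.factorial : ℝ) * (C * (μ * ρ) ^ n) := by
  obtain ⟨C, hC, h⟩ := exists_rising_le ((i : ℝ) + γ) hρ
  set a : ℕ → ℝ := fun m => |rising (-(i : ℝ)) m / (m.factorial : ℝ)| * (μ ^ m)⁻¹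
  have ha : Summable a := summable_of_ne_finset_zero (s := range (i + 1)) fun m hm => by
    simp only [mem_range, not_lt] at hm
    simp [a, rising_neg_natCast_eq_zero (R := ℝ) hm]
  have ha0 : ∀ m, 0 ≤ a m := fun m => by positivity
  have ha1 := tsum_nonneg (L := .unconditional ℕ) ha0
  refine ⟨C * (∑' m, a m + 1), mul_pos hC (by linarith), fun n => ?_⟩
  have he := map_meixnerPoly_eq_factorial_mul (γ := γ) (μ := μ) (evalRingHom (i : ℝ)) n
  simp only [coe_evalRingHom, eval_X, eval_C] at he
  rw [he, abs_mul, Nat.abs_cast]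
  gcongr
  calc _ ≤ ∑ k ∈ range (n + 1), a (n - k) * (C * (μ * ρ) ^ n) := by
        refine (abs_sum_le_sum_abs _ _).trans (sum_le_sum fun k hk => ?_)
        have hk : k ≤ n := Nat.lt_succ_iff.1 (mem_range.1 hk)
        have hv : 0 ≤ rising ((i : ℝ) + γ) k := rising_nonneg (by positivity) k
        rw [abs_mul, abs_of_nonneg (a := rising ((i : ℝ) + γ) k / (k.factorial : ℝ) * μ ^ k)
          (by positivity)]
        have hμn : μ ^ n = μ ^ (n - k) * μ ^ k := by rw [← pow_add, Nat.sub_add_cancel hk]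
        calc _ ≤ |rising (-(i : ℝ)) (n - k) / ((n - k).factorial : ℝ)| * (C * ρ ^ n * μ ^ k) := by
              gcongr
              refine (h k).trans ?_
              gcongr
              exact hρ.le
          _ = _ := by
              simp only [a]
              rw [mul_pow, hμn]
              field_simp
    _ = (∑ k ∈ range (n + 1), a k) * (C * (μ * ρ) ^ n) := by rw [← sum_mul, sum_flip]
    _ ≤ (∑' m, a m + 1) * (C * (μ * ρ) ^ n) := by
        gcongr
        linarith [ha.sum_le_tsum (range (n + 1)) fun m _ => ha0 m]
    _ = _ := by ring

lemma exists_abs_fwdDiffZero_meixnerPoly_le (hγ : 0 < γ) (hμ0 : 0 < μ) (j : ℕ) {ρ : ℝ}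
    (hρ : 1 < ρ) :
    ∃ C : ℝ, 0 < C ∧ ∀ n : ℕ,
      |fwdDiffZero j (meixnerPoly γ μ n)| ≤ (n.factorial : ℝ) * (C * (μ * ρ) ^ n) := by
  choose B hB0 hB using fun i => exists_abs_eval_natCast_meixnerPoly_le hγ hμ0 i hρ
  refine ⟨∑ i ∈ range (j + 1), (j.choose i : ℝ) * B i, ?_, fun n => ?_⟩
  · refine sum_pos (fun i hi => mul_pos ?_ (hB0 i)) (by simp)
    exact_mod_cast Nat.choose_pos (Nat.lt_succ_iff.1 (mem_range.1 hi))
  · refine (abs_fwdDiffZero_le j _).trans ?_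
    rw [sum_mul, mul_sum]
    refine sum_le_sum fun i _ => ?_
    calc _ ≤ (j.choose i : ℝ) * ((n.factorial : ℝ) * (B i * (μ * ρ) ^ n)) := by
          gcongr
          exact hB i n
      _ = _ := by ring

lemma exists_factorial_div_rising_le (hγ : 0 < γ) {ρ : ℝ} (hρ : 1 < ρ) :
    ∃ C : ℝ, 0 < C ∧ ∀ k : ℕ, (k.factorial : ℝ) / rising γ k ≤ C * ρ ^ k := by
  obtain ⟨C, hC, h⟩ := exists_gammaRatio_le (isCompact_singleton (x := -(γ : ℂ))) hρ
  have hΓ : 0 < Real.Gamma γ := Real.Gamma_pos_of_pos hγ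
  refine ⟨C * Real.Gamma γ, by positivity, fun k => ?_⟩
  have h1 := h 0 k _ rfl
  have h2 := rising_neg_mul_inv_Gamma k (-(γ : ℂ))
  have h3 : (rising (γ : ℂ) k) = ((rising γ k : ℝ) : ℂ) :=
    (map_rising Complex.ofRealHom γ k).symm
  rw [neg_neg, h3, Complex.Gamma_ofReal] at h2
  have hr := rising_pos hγ k
  have h4 : (Complex.Gamma ((k : ℂ) - -(γ : ℂ)))⁻¹
      = (((rising γ k)⁻¹ * (Real.Gamma γ)⁻¹ : ℝ) : ℂ) := by
    push_cast
    rw [← h2, inv_mul_cancel_left₀ (by exact_mod_cast hr.ne')]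
  rw [gammaRatio_zero_left, h4, norm_mul, Complex.norm_natCast,
    Complex.norm_of_nonneg (by positivity)] at h1
  calc _ = (k.factorial : ℝ) * ((rising γ k)⁻¹ * (Real.Gamma γ)⁻¹) * Real.Gamma γ := by
        field_simp
    _ ≤ C * ρ ^ k * Real.Gamma γ := by gcongr
    _ = _ := by ring

end Asymptotics

section Sobolev

variable {γ μ : ℝ}

lemma exists_kernel_term_le (hγ : 0 < γ) (hμ0 : 0 < μ) (hμ1 : μ < 1) (j : ℕ) {K : Set ℂ}
    (hK : IsCompact K) {ρ : ℝ} (hρ : 1 < ρ) :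
    ∃ C : ℝ, 0 < C ∧ ∀ k : ℕ, ∀ x ∈ K,
      ‖aeval x ((fwdDiffZero j (meixnerPoly γ μ k) / meixnerNormSq γ μ k) •
        meixnerPoly γ μ k)‖ ≤ C * (ρ ^ 3) ^ k := by
  obtain ⟨C₁, hC₁, h₁⟩ := exists_abs_fwdDiffZero_meixnerPoly_le hγ hμ0 j hρ
  obtain ⟨C₂, hC₂, h₂⟩ := exists_norm_aeval_meixnerPoly_le (γ := γ) hμ0 hμ1 hK hρ
  obtain ⟨C₃, hC₃, h₃⟩ := exists_factorial_div_rising_le hγ hρ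
  have hE := Real.exp_pos (-(γ * Real.log (1 - μ)))
  refine ⟨C₁ * C₂ * C₃ / Real.exp (-(γ * Real.log (1 - μ))), by positivity, fun k x hx => ?_⟩
  have hH := meixnerNormSq_pos hγ hμ0 k
  have hr := rising_pos hγ k
  rw [map_smul, norm_smul, Real.norm_eq_abs, abs_div, abs_of_pos hH]
  calc _ ≤ (k.factorial : ℝ) * (C₁ * (μ * ρ) ^ k) / meixnerNormSq γ μ k *
        ((k.factorial : ℝ) * (C₂ * ρ ^ k)) := by
        gcongr
        · exact h₁ k
        · exact h₂ k x hx
    _ = C₁ * C₂ / Real.exp (-(γ * Real.log (1 - μ))) * ρ ^ (2 * k) *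
        ((k.factorial : ℝ) / rising γ k) := by
        rw [meixnerNormSq, mul_pow]
        field_simp
        ring
    _ ≤ C₁ * C₂ / Real.exp (-(γ * Real.log (1 - μ))) * ρ ^ (2 * k) * (C₃ * ρ ^ k) := by
        gcongr
        exact h₃ k
    _ = _ := by ring

variable {lam : ℝ} {j : ℕ} {Q : ℕ → ℝ[X]}

lemma tendstoUniformlyOn_smul_sub_meixnerPoly (hγ : 0 < γ) (hμ0 : 0 < μ) (hμ1 : μ < 1)
    (hlam : 0 < lam) (hQ : ∀ n, IsSobolevOP γ μ lam 0 1 j n (Q n)) {K : Set ℂ}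
    (hK : IsCompact K) :
    TendstoUniformlyOn
      (fun (n : ℕ) (x : ℂ) =>
        aeval x ((μ - 1) ^ n • Q n - meixnerPoly γ μ n) * (Complex.Gamma ((n : ℂ) - x))⁻¹)
      (fun _ => 0) atTop K := by
  obtain ⟨ρ, hρ, hρμ⟩ := exists_one_lt_mul_pow_lt_one hμ1 5
  obtain ⟨C₁, hC₁, h₁⟩ := exists_abs_fwdDiffZero_meixnerPoly_le hγ hμ0 j hρ
  obtain ⟨C₂, hC₂, h₂⟩ := exists_kernel_term_le hγ hμ0 hμ1 j hK hρ
  obtain ⟨C₃, hC₃, h₃⟩ := exists_gammaRatio_le hK hρ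
  have hbound : ∀ n : ℕ, ∀ x ∈ K, ‖aeval x ((μ - 1) ^ n • Q n - meixnerPoly γ μ n) *
      (Complex.Gamma ((n : ℂ) - x))⁻¹‖ ≤ lam * C₁ * C₂ * C₃ * (n * (μ * ρ ^ 5) ^ n) := by
    intro n x hx
    have hd := ((hQ n).abs_fwdDiffZero_le hγ hμ0 hμ1 hlam).trans (h₁ n)
    have hsum : ‖aeval x (∑ k ∈ range n, (fwdDiffZero j (meixnerPoly γ μ k) /
        meixnerNormSq γ μ k) • meixnerPoly γ μ k)‖ ≤ n * (C₂ * (ρ ^ 3) ^ n) := by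
      rw [map_sum]
      refine (norm_sum_le_of_le _ fun k hk => (h₂ k x hx).trans
        (?_ : _ ≤ C₂ * (ρ ^ 3) ^ n)).trans (by simp)
      gcongr
      · exact one_le_pow₀ hρ.le
      · exact (mem_range.1 hk).le
    have hG := h₃ 0 n x hx
    rw [gammaRatio_zero_left, norm_mul, Complex.norm_natCast] at hG
    rw [sub_eq_iff_eq_add'.2 (((hQ n).smul_eq hγ hμ0 hμ1).trans (sub_eq_add_neg _ _)), map_neg,
      map_smul, norm_mul, norm_neg, norm_smul, norm_mul, Real.norm_of_nonneg hlam.le,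
      Real.norm_eq_abs]
    calc _ ≤ lam * ((n.factorial : ℝ) * (C₁ * (μ * ρ) ^ n)) * (n * (C₂ * (ρ ^ 3) ^ n)) *
          ‖(Complex.Gamma ((n : ℂ) - x))⁻¹‖ := by gcongr
      _ = lam * (C₁ * (μ * ρ) ^ n) * (n * (C₂ * (ρ ^ 3) ^ n)) *
          ((n.factorial : ℝ) * ‖(Complex.Gamma ((n : ℂ) - x))⁻¹‖) := by ring
      _ ≤ lam * (C₁ * (μ * ρ) ^ n) * (n * (C₂ * (ρ ^ 3) ^ n)) * (C₃ * ρ ^ n) := by gcongr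
      _ = lam * C₁ * C₂ * C₃ * (n * (μ ^ n * (ρ ^ n * (ρ ^ 3) ^ n * ρ ^ n))) := by ring
      _ = _ := by rw [← mul_pow, ← mul_pow, ← mul_pow]; ring
  have h0 := (tendsto_self_mul_const_pow_of_lt_one (r := μ * ρ ^ 5) (by positivity)
    hρμ).const_mul (lam * C₁ * C₂ * C₃)
  rw [mul_zero] at h0
  rw [Metric.tendstoUniformlyOn_iff]
  intro ε hε
  filter_upwards [h0.eventually_lt_const hε] with n hn x hx
  rw [dist_zero_left]
  exact (hbound n x hx).trans_lt hn

end Sobolev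

/-- Mehler–Heine type formula for `Q_n^{(1)}` when `α = 0`. -/
theorem sobolev_mehler_heine (γ μ lam : ℝ) (hγ : 0 < γ) (hμ0 : 0 < μ) (hμ1 : μ < 1)
    (hlam : 0 < lam) (j : ℕ) (Q : ℕ → Polynomial ℝ)
    (hQ : ∀ n : ℕ, IsSobolevOP γ μ lam 0 1 j n (Q n)) :
    ∀ K : Set ℂ, IsCompact K →
      TendstoUniformlyOn
        (fun (n : ℕ) (x : ℂ) =>
          ((μ : ℂ) - 1) ^ n * ((Q n).map (algebraMap ℝ ℂ)).eval x /
            Complex.Gamma ((n : ℂ) - x))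
        (fun x => 1 /
          (Complex.exp ((↑γ + x) * (Real.log (1 - μ) : ℂ)) * Complex.Gamma (-x)))
        atTop K := by
  intro K hK
  have h := (tendstoUniformlyOn_meixnerPoly (γ := γ) hμ0 hμ1 hK).add
    (tendstoUniformlyOn_smul_sub_meixnerPoly hγ hμ0 hμ1 hlam hQ hK)
  refine (h.congr (Eventually.of_forall fun n x _ => ?_)).congr_right fun x _ => ?_
  · have hx : aeval x ((μ - 1) ^ n • Q n) =
        ((μ : ℂ) - 1) ^ n * ((Q n).map (algebraMap ℝ ℂ)).eval x := by
      rw [map_smul, eval_map_algebraMap, Complex.real_smul]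
      push_cast
      rfl
    simp only [Pi.add_apply]
    rw [div_eq_mul_inv, ← hx, ← add_mul, map_sub, add_sub_cancel]
  · simp only [Pi.add_apply]
    rw [add_zero, one_div, mul_inv, Complex.exp_neg, add_comm x, mul_comm]
end
end
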